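/- arXiv:2008.08110 — 7 statements merged into one kernel-verified Lean document; each statement's English description precedes it below -/
import Mathlib

section
/- Let S be a numerical semigroup with S ≠ ℕ. Then the genus of its T-set satisfies g(T(S)) = F(S) − g(S); moreover, if S is not ordinary (i.e. m(S) < F(S)), then T(S) ≠ ℕ and F(T(S)) = F(S) − m(S). -/
open scoped Classical

/-- A numerical set: a subset of ℕ containing 0 with finite complement. -/
def NumericalSet (H : Set ℕ) : Prop := 0 ∈ H ∧ Hᶜ.Finite

/-- A numerical semigroup: a numerical set closed under addition. -/
def NumericalSemigroup (S : Set ℕ) : Prop :=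
  NumericalSet S ∧ ∀ a ∈ S, ∀ b ∈ S, a + b ∈ S

/-- Frobenius number: the largest gap. -/
noncomputable def frob (H : Set ℕ) : ℕ := sSup Hᶜ

/-- Genus: the number of gaps. -/
noncomputable def genus (H : Set ℕ) : ℕ := Hᶜ.ncard

/-- Multiplicity: the smallest nonzero element. -/
noncomputable def mult (H : Set ℕ) : ℕ := sInf {x | x ∈ H ∧ x ≠ 0}

/-- The T-set of a numerical set.  (With truncated subtraction, every `x ≥ frob H`
satisfies `frob H - x = 0`, matching the convention that `F(H) - x` computed in ℤ
is nonpositive, hence not a nonzero element of `H`.) -/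
def Tset (H : Set ℕ) : Set ℕ := {x | frob H - x ∉ H ∨ frob H - x = 0}

/-- The associated numerical semigroup of a numerical set. -/
def A (H : Set ℕ) : Set ℕ := {x | ∀ h ∈ H, x + h ∈ H}

/-- `A*`-operation on numerical sets. -/
def Astar (H : Set ℕ) : Set ℕ := {a | ∀ h ∈ H, h ≠ 0 → a + h ∈ H}

/-- Pseudo-Frobenius numbers of a numerical set. -/
def PF (H : Set ℕ) : Set ℕ := {a | a ∉ H ∧ ∀ h ∈ H, h ≠ 0 → a + h ∈ H}

/-- Type of a numerical set. -/
noncomputable def typ (H : Set ℕ) : ℕ := (PF H).ncard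

/-- Almost symmetric: `t(S) = 2 g(S) - F(S)`. -/
def AlmostSymmetric (S : Set ℕ) : Prop :=
  (typ S : ℤ) = 2 * (genus S : ℤ) - (frob S : ℤ)

/-- An ordinary numerical set: `{0} ∪ {x : x > F(H)}`. -/
def Ordinary (H : Set ℕ) : Prop := H = insert 0 {x : ℕ | frob H < x}

theorem NumericalSet.isGreatest_frob {H : Set ℕ} (hH : NumericalSet H) (hne : H ≠ Set.univ) :
    IsGreatest Hᶜ (frob H) :=
  ⟨Nat.sSup_mem (Set.nonempty_compl.mpr hne) hH.2.bddAbove,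
    fun _ hx => le_csSup hH.2.bddAbove hx⟩

theorem NumericalSet.isLeast_mult {H : Set ℕ} (hH : NumericalSet H) :
    IsLeast {x | x ∈ H ∧ x ≠ 0} (mult H) := by
  have hnonempty : {x | x ∈ H ∧ x ≠ 0}.Nonempty := by
    obtain ⟨b, hb⟩ := hH.2.bddAbove
    refine ⟨b + 1, ?_, b.succ_ne_zero⟩
    by_contra hmem
    exact absurd (hb hmem) (by omega)
  exact ⟨Nat.sInf_mem hnonempty, fun _ hx => Nat.sInf_le hx⟩

theorem mem_compl_Tset {H : Set ℕ} {x : ℕ} :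
    x ∈ (Tset H)ᶜ ↔ frob H - x ∈ H ∧ frob H - x ≠ 0 := by
  simp [Tset]

theorem NumericalSet.genus_Tset_add_genus {H : Set ℕ} (hH : NumericalSet H)
    (hne : H ≠ Set.univ) : genus (Tset H) + genus H = frob H := by
  have hF := hH.isGreatest_frob hne
  have hgaps : Hᶜ = ((Finset.Icc 1 (frob H)).filter (· ∉ H) : Finset ℕ) := by
    ext x
    simp only [Set.mem_compl_iff, Finset.coe_filter, Finset.mem_Icc, Set.mem_ofPred_eq]
    refine ⟨fun hx => ⟨⟨Nat.one_le_iff_ne_zero.mpr ?_, hF.2 hx⟩, hx⟩, fun hx => hx.2⟩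
    rintro rfl
    exact hx hH.1
  have hTgaps : (Tset H)ᶜ =
      (fun y => frob H - y) '' ((Finset.Icc 1 (frob H)).filter (· ∈ H) : Finset ℕ) := by
    ext x
    simp only [mem_compl_Tset, Finset.coe_filter, Finset.mem_Icc, Set.mem_image,
      Set.mem_ofPred_eq]
    constructor
    · rintro ⟨hx, hx0⟩
      exact ⟨frob H - x, ⟨⟨by omega, by omega⟩, hx⟩, by omega⟩
    · rintro ⟨y, ⟨⟨hy1, hyF⟩, hy⟩, rfl⟩
      rw [Nat.sub_sub_self hyF]
      exact ⟨hy, by omega⟩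
  have hinj : Set.InjOn (fun y => frob H - y)
      ((Finset.Icc 1 (frob H)).filter (· ∈ H) : Finset ℕ) := by
    intro a ha b hb hab
    simp only [Finset.coe_filter, Finset.mem_Icc, Set.mem_ofPred_eq] at ha hb hab
    omega
  rw [genus, genus, hTgaps, hinj.ncard_image, hgaps, Set.ncard_coe_finset,
    Set.ncard_coe_finset, Finset.card_filter_add_card_filter_not, Nat.card_Icc,
    Nat.add_sub_cancel]

theorem NumericalSet.isGreatest_compl_Tset {H : Set ℕ} (hH : NumericalSet H)
    (hlt : mult H < frob H) : IsGreatest (Tset H)ᶜ (frob H - mult H) := by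
  have hm := hH.isLeast_mult
  refine ⟨?_, fun x hx => ?_⟩
  · rw [mem_compl_Tset, Nat.sub_sub_self hlt.le]
    exact hm.1
  · have hx := mem_compl_Tset.mp hx
    have := hm.2 hx
    omega

theorem stmt_0 (S : Set ℕ) (hS : NumericalSemigroup S) (hne : S ≠ Set.univ) :
    (genus (Tset S) : ℤ) = (frob S : ℤ) - (genus S : ℤ) ∧
    (mult S < frob S →
      Tset S ≠ Set.univ ∧ (frob (Tset S) : ℤ) = (frob S : ℤ) - (mult S : ℤ)) := by
  refine ⟨?_, fun hlt => ?_⟩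
  · have := hS.1.genus_Tset_add_genus hne
    omega
  · have hT := hS.1.isGreatest_compl_Tset hlt
    refine ⟨Set.nonempty_compl.mp hT.nonempty, ?_⟩
    rw [frob, hT.csSup_eq, Nat.cast_sub hlt.le]
end

section
/- Let S be a numerical semigroup with S ≠ ℕ. Then A(T(S)) = S ∪ PF(S), and consequently t(S) = g(S) − g(A(T(S))). -/
open scoped Classical

theorem union_PF_eq_Astar {S : Set ℕ} (hS : NumericalSemigroup S) : S ∪ PF S = Astar S := by
  ext x
  refine ⟨?_, fun h => ?_⟩
  · rintro (hx | hx)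
    · exact fun s hs _ => hS.2 x hx s hs
    · exact hx.2
  · by_cases hx : x ∈ S
    · exact Or.inl hx
    · exact Or.inr ⟨hx, h⟩

theorem le_frob {H : Set ℕ} (hH : NumericalSet H) {x : ℕ} (hx : x ∉ H) : x ≤ frob H :=
  le_csSup hH.2.bddAbove hx

theorem A_Tset_eq_Astar {H : Set ℕ} (hH : NumericalSet H) : A (Tset H) = Astar H := by
  ext x
  constructor
  · intro hx s hs hs0
    by_contra hxs
    have hle := le_frob hH hxs
    have hmem : frob H - (x + s) ∈ Tset H := by
      left
      rwa [Nat.sub_sub_self hle]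
    have hsub : frob H - (x + (frob H - (x + s))) = s := by omega
    have hcontra := hx _ hmem
    simp only [Tset, Set.mem_ofPred_eq, hsub] at hcontra
    exact hcontra.elim (· hs) hs0
  · intro hx h hh
    by_contra hcontra
    simp only [Tset, Set.mem_ofPred_eq, not_or, not_not] at hcontra hh
    have hmem := hx _ hcontra.1 hcontra.2
    have hsub : x + (frob H - (x + h)) = frob H - h := by omega
    rw [hsub] at hmem
    rcases hh with hh | hh
    · exact hh hmem
    · omega

theorem genus_eq_typ_add_genus {S : Set ℕ} (hS : NumericalSet S) :
    genus S = typ S + genus (S ∪ PF S) := by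
  have hsub : PF S ⊆ Sᶜ := fun _ hx => hx.1
  rw [genus, genus, typ, Set.compl_union, ← Set.sdiff_eq, add_comm]
  exact (Set.ncard_sdiff_add_ncard_of_subset hsub hS.2).symm

theorem stmt_1 (S : Set ℕ) (hS : NumericalSemigroup S) (hne : S ≠ Set.univ) :
    A (Tset S) = S ∪ PF S ∧
    (typ S : ℤ) = (genus S : ℤ) - (genus (A (Tset S)) : ℤ) := by
  have hA : A (Tset S) = S ∪ PF S := (A_Tset_eq_Astar hS.1).trans (union_PF_eq_Astar hS).symm
  refine ⟨hA, ?_⟩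
  rw [hA, genus_eq_typ_add_genus hS.1]
  push_cast
  ring
end

section
/- Let T be a numerical set with T ≠ ℕ and Frobenius number f = F(T), and let F be an integer with F > 2f. Define S = {0} ∪ (ℕ \ {F − t : t ∈ T, t ≤ F}). Then S is a numerical semigroup with Frobenius number F, its T-set satisfies T(S) = T, and its type is t(S) = F − g(T) − g(A(T)). -/
open scoped Classical

theorem mem_of_frob_lt {T : Set ℕ} (hT : Tᶜ.Finite) {x : ℕ} (hx : frob T < x) : x ∈ T := by
  by_contra h
  exact absurd (le_csSup hT.bddAbove (show x ∈ Tᶜ from h)) (not_le.mpr hx)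

theorem mem_insert_zero_compl_reflect_iff {T : Set ℕ} {F x : ℕ} :
    x ∈ insert 0 {x : ℕ | ¬ ∃ t ∈ T, t ≤ F ∧ x = F - t} ↔ x = 0 ∨ F < x ∨ F - x ∉ T := by
  simp only [Set.mem_insert_iff, Set.mem_ofPred_eq]
  refine or_congr_right ⟨fun h => ?_, ?_⟩
  · by_contra! h'
    exact h ⟨F - x, h'.2, by omega, by omega⟩
  · rintro h ⟨t, ht, htF, rfl⟩
    rcases h with h | h
    · omega
    · exact h (by rwa [Nat.sub_sub_self htF])

theorem mem_PF_iff {T S : Set ℕ} {F : ℕ} (hgap : ∀ x, x ∉ T → x < F)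
    (hmem : ∀ x, x ∈ S ↔ x = 0 ∨ F < x ∨ F - x ∉ T) {a : ℕ} :
    a ∈ PF S ↔ a ∈ Set.Icc 1 F ∧ F - a ∈ T ∧ a ∈ A T := by
  have hout : a ∉ S ↔ a ∈ Set.Icc 1 F ∧ F - a ∈ T := by
    rw [hmem, Set.mem_Icc]
    by_cases h : F - a ∈ T <;> simp [h]
    omega
  change (a ∉ S ∧ ∀ h ∈ S, h ≠ 0 → a + h ∈ S) ↔ _
  rw [hout, and_assoc]
  refine and_congr_right fun ha => and_congr_right fun _ => ⟨fun h v hv => ?_, fun h s hs hs0 => ?_⟩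
  · rw [Set.mem_Icc] at ha
    by_contra hav
    have hlt := hgap _ hav
    have hS := h (F - (a + v)) ((hmem _).2 (.inr (.inr (by rwa [Nat.sub_sub_self hlt.le]))))
      (by omega)
    rcases (hmem _).1 hS with h | h | h
    · omega
    · omega
    · exact h (by rwa [show F - (a + (F - (a + v))) = v by omega])
  · rw [hmem]
    by_contra! hc
    rcases (hmem _).1 hs with h' | h' | h'
    · exact hs0 h'
    · omega
    · apply h'
      have := h _ hc.2.2
      rwa [show a + (F - (a + s)) = F - s by omega] at this

theorem stmt_4 (T : Set ℕ) (hT : NumericalSet T) (hTne : T ≠ Set.univ)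
    (F : ℕ) (hF : 2 * frob T < F)
    (S : Set ℕ) (hSdef : S = insert 0 {x : ℕ | ¬ ∃ t ∈ T, t ≤ F ∧ x = F - t}) :
    NumericalSemigroup S ∧ frob S = F ∧ Tset S = T ∧
    (typ S : ℤ) = (F : ℤ) - (genus T : ℤ) - (genus (A T) : ℤ) := by
  obtain ⟨h0, hfin⟩ := hT
  have hmem : ∀ x, x ∈ S ↔ x = 0 ∨ F < x ∨ F - x ∉ T := fun x => by
    rw [hSdef, mem_insert_zero_compl_reflect_iff]
  have hgap : ∀ x, x ∉ T → x ≤ frob T := fun x hx => by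
    by_contra! h
    exact hx (mem_of_frob_lt hfin h)
  have hlarge : ∀ x ∈ S, x ≠ 0 → F ≤ x + frob T := fun x hx hx0 => by
    rcases (hmem x).1 hx with h | h | h
    · exact absurd h hx0
    · omega
    · have := hgap _ h
      omega
  have hcompl : Sᶜ ⊆ Set.Iic F := fun x hx => by
    by_contra h
    exact hx ((hmem x).2 (.inr (.inl (not_le.mp h))))
  have hFS : F ∉ S := by
    rw [hmem]
    simp [h0]
    omega
  have hfrob : frob S = F :=
    IsGreatest.csSup_eq ⟨hFS, fun x hx => hcompl hx⟩
  refine ⟨⟨⟨(hmem 0).2 (.inl rfl), (Set.finite_Iic F).subset hcompl⟩, fun a ha b hb => ?_⟩,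
    hfrob, ?_, ?_⟩
  · rcases eq_or_ne a 0 with rfl | ha0
    · rwa [zero_add]
    rcases eq_or_ne b 0 with rfl | hb0
    · exact ha
    have := hlarge a ha ha0
    have := hlarge b hb hb0
    exact (hmem _).2 (.inr (.inl (by omega)))
  · ext x
    change (frob S - x ∉ S ∨ frob S - x = 0) ↔ x ∈ T
    rw [hfrob, hmem]
    rcases le_or_gt F x with hx | hx
    · have hxT : x ∈ T := mem_of_frob_lt hfin (by omega)
      simp [hxT, Nat.sub_eq_zero_of_le hx]
    · rw [Nat.sub_sub_self hx.le]
      by_cases hxT : x ∈ T <;> simp [hxT] <;> omega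
  · have hPF : ∀ a, a ∈ PF S ↔ a ∈ Set.Icc 1 F ∧ F - a ∈ T ∧ a ∈ A T := fun a =>
      mem_PF_iff (fun x hx => by have := hgap x hx; omega) hmem
    have hA0 : 0 ∈ A T := fun h hh => by rwa [zero_add]
    have hAgap : ∀ a, a ∉ A T → a ≤ frob T := fun a ha => by
      by_contra! h
      exact ha fun v _ => mem_of_frob_lt hfin (by omega)
    have hAfin : (A T)ᶜ.Finite := (Set.finite_Iic (frob T)).subset hAgap
    have hPFfin : (PF S).Finite := (Set.finite_Icc 1 F).subset fun a ha => ((hPF a).1 ha).1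
    have hinj : Set.InjOn (fun t => F - t) Tᶜ := fun a ha b hb hab => by
      have := hgap a ha
      have := hgap b hb
      simp only at hab
      omega
    have hunion : Set.Icc 1 F = PF S ∪ ((A T)ᶜ ∪ (fun t => F - t) '' Tᶜ) := by
      ext a
      constructor
      · intro ha
        by_cases h1 : a ∈ A T
        · by_cases h2 : F - a ∈ T
          · exact .inl ((hPF a).2 ⟨ha, h2, h1⟩)
          · exact .inr (.inr ⟨F - a, h2, Nat.sub_sub_self ha.2⟩)
        · exact .inr (.inl h1)
      · rintro (h | h | ⟨t, ht, rfl⟩)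
        · exact ((hPF a).1 h).1
        · have := hAgap a h
          have : a ≠ 0 := fun h' => h (h' ▸ hA0)
          rw [Set.mem_Icc]
          omega
        · have := hgap t ht
          simp only [Set.mem_Icc]
          omega
    have hdisj₁ : Disjoint (A T)ᶜ ((fun t => F - t) '' Tᶜ) := by
      rw [Set.disjoint_left]
      rintro _ ha ⟨t, ht, rfl⟩
      have := hAgap _ ha
      have := hgap t ht
      simp only at *
      omega
    have hdisj₂ : Disjoint (PF S) ((A T)ᶜ ∪ (fun t => F - t) '' Tᶜ) := by
      rw [Set.disjoint_left]
      rintro a ha (h | ⟨t, ht, rfl⟩)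
      · exact h ((hPF a).1 ha).2.2
      · have h1 := ((hPF _).1 ha).2.1
        have := hgap t ht
        rw [Nat.sub_sub_self (by omega)] at h1
        exact ht h1
    have hcard := congrArg Set.ncard hunion
    rw [Set.ncard_union_eq hdisj₂ hPFfin (hAfin.union (hfin.image _)),
      Set.ncard_union_eq hdisj₁ hAfin (hfin.image _), hinj.ncard_image,
      ← Finset.coe_Icc, Set.ncard_coe_finset, Nat.card_Icc] at hcard
    unfold typ genus
    omega
end

section
/- Let β and F be positive integers with F > 8β − 6. Then the map S ↦ T(S) is a bijection from the set of almost symmetric numerical semigroups with Frobenius number F and type F − 2β onto the set of numerical semigroups of genus β. -/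
open scoped Classical

theorem NumericalSet.mem_of_frob_lt {H : Set ℕ} (hH : NumericalSet H) {x : ℕ}
    (hx : frob H < x) : x ∈ H := by
  by_contra hxH
  exact absurd (le_csSup hH.2.bddAbove hxH) (not_le.mpr hx)

theorem frob_notMem {H : Set ℕ} (hH : NumericalSet H) (h : 0 < frob H) : frob H ∉ H := by
  have hne : Hᶜ.Nonempty := by
    by_contra hn
    rw [Set.not_nonempty_iff_eq_empty] at hn
    simp [frob, hn] at h
  exact Nat.sSup_mem hne hH.2.bddAbove

theorem compl_Tset (H : Set ℕ) : (Tset H)ᶜ = {x | frob H - x ∈ H ∧ frob H - x ≠ 0} := by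
  ext x
  simp [Tset]

theorem finite_compl_Tset (H : Set ℕ) : (Tset H)ᶜ.Finite := by
  refine (Set.finite_Iic (frob H)).subset fun x hx => ?_
  rw [compl_Tset] at hx
  have := hx.2
  rw [Set.mem_Iic]
  lia

theorem genus_add_genus_Tset {H : Set ℕ} (hH : NumericalSet H) :
    genus H + genus (Tset H) = frob H := by
  have himage : (Tset H)ᶜ = (fun x => frob H - x) '' (H ∩ Set.Icc 1 (frob H)) := by
    rw [compl_Tset]
    ext x
    constructor
    · rintro ⟨h1, h2⟩
      exact ⟨frob H - x, ⟨h1, by simp only [Set.mem_Icc]; lia⟩, by simp only; lia⟩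
    · rintro ⟨y, ⟨hy, hy1, hy2⟩, rfl⟩
      have hyy : frob H - (frob H - y) = y := by lia
      simp only [Set.mem_ofPred_eq, hyy]
      exact ⟨hy, by lia⟩
  have hinj : Set.InjOn (fun x => frob H - x) (H ∩ Set.Icc 1 (frob H)) := by
    rintro x ⟨-, hx1, hx2⟩ y ⟨-, hy1, hy2⟩ hxy
    simp only at hxy
    lia
  have hunion : Hᶜ ∪ (H ∩ Set.Icc 1 (frob H)) = Set.Icc 1 (frob H) := by
    ext x
    simp only [Set.mem_union, Set.mem_compl_iff, Set.mem_inter_iff, Set.mem_Icc]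
    constructor
    · rintro (hx | hx)
      · refine ⟨Nat.one_le_iff_ne_zero.mpr fun h0 => hx (h0 ▸ hH.1), ?_⟩
        by_contra hlt
        exact hx (hH.mem_of_frob_lt (not_le.mp hlt))
      · exact hx.2
    · tauto
  have hdisj : Disjoint Hᶜ (H ∩ Set.Icc 1 (frob H)) :=
    disjoint_compl_left.mono_right Set.inter_subset_left
  rw [genus, genus, himage, hinj.ncard_image,
    ← Set.ncard_union_eq hdisj hH.2 ((Set.finite_Icc _ _).inter_of_right _), hunion]
  simp [Set.ncard_eq_toFinset_card']

theorem NumericalSemigroup.subset_Tset {S : Set ℕ} (hS : NumericalSemigroup S)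
    (h : 0 < frob S) : S ⊆ Tset S := by
  intro x hx
  by_contra hT
  have hT : x ∈ (Tset S)ᶜ := hT
  rw [compl_Tset] at hT
  obtain ⟨h1, h2⟩ := hT
  refine frob_notMem hS.1 h ?_
  have := hS.2 _ hx _ h1
  rwa [Nat.add_sub_cancel' (by lia)] at this

theorem PF_subset_Tset_diff {S : Set ℕ} (hS : NumericalSet S) (h : 0 < frob S) :
    PF S ⊆ Tset S \ S := by
  rintro x ⟨hxS, hx⟩
  refine ⟨?_, hxS⟩
  by_contra hT
  have hT : x ∈ (Tset S)ᶜ := hT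
  rw [compl_Tset] at hT
  obtain ⟨h1, h2⟩ := hT
  refine frob_notMem hS h ?_
  have := hx _ h1 h2
  rwa [Nat.add_sub_cancel' (by lia)] at this

theorem NumericalSemigroup.genus_eq_add_ncard {S : Set ℕ} (hS : NumericalSemigroup S)
    (h : 0 < frob S) : genus S = genus (Tset S) + (Tset S \ S).ncard := by
  have hsub := hS.subset_Tset h
  have hunion : Sᶜ = (Tset S)ᶜ ∪ (Tset S \ S) := by
    ext x
    have := @hsub x
    simp only [Set.mem_union, Set.mem_compl_iff, Set.mem_sdiff]
    by_cases hxT : x ∈ Tset S <;> simp_all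
  have hdisj : Disjoint (Tset S)ᶜ (Tset S \ S) :=
    disjoint_compl_left.mono_right Set.sdiff_subset
  rw [genus, hunion, Set.ncard_union_eq hdisj (finite_compl_Tset S)
    (hS.1.2.subset fun x hx => hx.2), genus]

theorem NumericalSemigroup.almostSymmetric_iff {S : Set ℕ} (hS : NumericalSemigroup S)
    (h : 0 < frob S) : AlmostSymmetric S ↔ PF S = Tset S \ S := by
  have h1 := hS.genus_eq_add_ncard h
  have h2 := genus_add_genus_Tset hS.1
  constructor
  · intro ha
    refine Set.eq_of_subset_of_ncard_le (PF_subset_Tset_diff hS.1 h) ?_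
      (hS.1.2.subset fun x hx => hx.2)
    rw [AlmostSymmetric, typ] at ha
    lia
  · intro he
    rw [AlmostSymmetric, typ, he]
    lia

theorem NumericalSemigroup.Tset_of_almostSymmetric {S : Set ℕ} (hS : NumericalSemigroup S)
    (h : 0 < frob S) (ha : AlmostSymmetric S) : NumericalSemigroup (Tset S) := by
  have hPF := (hS.almostSymmetric_iff h).mp ha
  have hsub := hS.subset_Tset h
  have hadd : ∀ x ∈ Tset S, ∀ s ∈ S, s ≠ 0 → x + s ∈ S := by
    intro x hx s hs hs0
    by_cases hxS : x ∈ S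
    · exact hS.2 x hxS s hs
    · have hxPF : x ∈ PF S := hPF ▸ ⟨hx, hxS⟩
      exact hxPF.2 s hs hs0
  refine ⟨⟨hsub hS.1.1, finite_compl_Tset S⟩, fun a haT b hbT => ?_⟩
  by_cases hab : a + b ∈ S
  · exact hsub hab
  · have hmem : a + b ∈ PF S := by
      refine ⟨hab, fun s hs hs0 => ?_⟩
      rw [add_assoc]
      exact hadd a haT _ (hadd b hbT s hs hs0) (by lia)
    exact (PF_subset_Tset_diff hS.1 h hmem).1

theorem mem_iff_sub_notMem_Tset {H : Set ℕ} {x : ℕ} (hx0 : x ≠ 0) (hx : x ≤ frob H) :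
    x ∈ H ↔ frob H - x ∉ Tset H := by
  rw [← Set.mem_compl_iff, compl_Tset, Set.mem_ofPred_eq, Nat.sub_sub_self hx]
  tauto

theorem eq_of_Tset_eq {H K : Set ℕ} (hH : NumericalSet H) (hK : NumericalSet K)
    (hf : frob H = frob K) (hT : Tset H = Tset K) : H = K := by
  ext x
  rcases eq_or_ne x 0 with rfl | hx0
  · exact iff_of_true hH.1 hK.1
  rcases le_or_gt x (frob H) with hx | hx
  · rw [mem_iff_sub_notMem_Tset hx0 hx, mem_iff_sub_notMem_Tset hx0 (hf ▸ hx), hf, hT]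
  · exact iff_of_true (hH.mem_of_frob_lt hx) (hK.mem_of_frob_lt (hf ▸ hx))

theorem NumericalSemigroup.lt_two_mul_genus {T : Set ℕ} (hT : NumericalSemigroup T) {x : ℕ}
    (hx : x ∉ T) : x < 2 * genus T := by
  have hcover : Set.Iic x ⊆ Tᶜ ∪ (fun y => x - y) '' Tᶜ := by
    intro i hi
    rw [Set.mem_Iic] at hi
    by_cases hiT : i ∈ T
    · refine Or.inr ⟨x - i, fun hxi => hx ?_, Nat.sub_sub_self hi⟩
      simpa [Nat.add_sub_cancel' hi] using hT.2 i hiT _ hxi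
    · exact Or.inl hiT
  have h1 := Set.ncard_le_ncard hcover (hT.1.2.union (hT.1.2.image _))
  have h2 := Set.ncard_union_le Tᶜ ((fun y => x - y) '' Tᶜ)
  have h3 := Set.ncard_image_le (f := fun y => x - y) hT.1.2
  have h4 : (Set.Iic x).ncard = x + 1 := by simp [Set.ncard_eq_toFinset_card']
  rw [genus]
  lia

/-- The numerical set with Frobenius number `F` whose T-set is `T`. -/
def dualSet (T : Set ℕ) (F : ℕ) : Set ℕ := {x | x = 0 ∨ F < x ∨ (x ≤ F ∧ F - x ∉ T)}

theorem finite_compl_dualSet (T : Set ℕ) (F : ℕ) : (dualSet T F)ᶜ.Finite := by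
  refine (Set.finite_Iic F).subset fun x hx => ?_
  by_contra hlt
  exact hx (Or.inr (Or.inl (not_le.mp hlt)))

theorem numericalSet_dualSet (T : Set ℕ) (F : ℕ) : NumericalSet (dualSet T F) :=
  ⟨Or.inl rfl, finite_compl_dualSet T F⟩

theorem frob_dualSet {T : Set ℕ} {F : ℕ} (h0 : 0 ∈ T) (hF : 0 < F) :
    frob (dualSet T F) = F := by
  refine IsGreatest.csSup_eq ⟨?_, fun x hx => ?_⟩
  · rintro (h | h | ⟨-, h⟩)
    · lia
    · lia
    · exact h (by simpa using h0)
  · by_contra hlt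
    exact hx (Or.inr (Or.inl (not_le.mp hlt)))

theorem Tset_dualSet {T : Set ℕ} {F : ℕ} (h0 : 0 ∈ T) (hF : 0 < F)
    (hgap : ∀ x ∉ T, x < F) : Tset (dualSet T F) = T := by
  rw [← compl_inj_iff, compl_Tset, frob_dualSet h0 hF]
  ext x
  simp only [dualSet, Set.mem_ofPred_eq, Set.mem_compl_iff]
  constructor
  · rintro ⟨h1 | h1 | h1, h2⟩
    · exact absurd h1 h2
    · lia
    · rw [Nat.sub_sub_self (by lia)] at h1
      exact h1.2
  · intro hx
    have := hgap x hx
    refine ⟨Or.inr (Or.inr ⟨Nat.sub_le _ _, ?_⟩), by lia⟩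
    rwa [Nat.sub_sub_self this.le]

theorem numericalSemigroup_dualSet {T : Set ℕ} {F : ℕ} (hgap : ∀ x ∉ T, 2 * x < F) :
    NumericalSemigroup (dualSet T F) := by
  refine ⟨numericalSet_dualSet T F, ?_⟩
  have hlarge : ∀ a ∈ dualSet T F, a ≠ 0 → F < 2 * a := by
    rintro a (ha | ha | ⟨ha, haT⟩) ha0
    · exact absurd ha ha0
    · lia
    · have := hgap _ haT
      lia
  intro a ha b hb
  rcases eq_or_ne a 0 with rfl | ha0
  · simpa using hb
  rcases eq_or_ne b 0 with rfl | hb0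
  · simpa using ha
  have h1 := hlarge a ha ha0
  have h2 := hlarge b hb hb0
  exact Or.inr (Or.inl (by lia))

theorem almostSymmetric_dualSet {T : Set ℕ} {F : ℕ} (hT : NumericalSemigroup T) (hF : 0 < F)
    (hgap : ∀ x ∉ T, 2 * x < F) : AlmostSymmetric (dualSet T F) := by
  have hfrob := frob_dualSet hT.1.1 hF
  have hpos : 0 < frob (dualSet T F) := by rwa [hfrob]
  have hS := numericalSemigroup_dualSet hgap
  rw [hS.almostSymmetric_iff hpos]
  refine (PF_subset_Tset_diff hS.1 hpos).antisymm ?_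
  rw [Tset_dualSet hT.1.1 hF fun x hx => by have := hgap x hx; lia]
  rintro t ⟨htT, htS⟩
  refine ⟨htS, ?_⟩
  rintro s (hs | hs | ⟨hs, hsT⟩) hs0
  · exact absurd hs hs0
  · exact Or.inr (Or.inl (by lia))
  · rcases lt_or_ge F (t + s) with hlt | hle
    · exact Or.inr (Or.inl hlt)
    · refine Or.inr (Or.inr ⟨hle, fun hmem => hsT ?_⟩)
      have := hT.2 t htT _ hmem
      rwa [show t + (F - (t + s)) = F - s by lia] at this

theorem stmt_6 (β F : ℕ) (hβ : 0 < β) (hF : 0 < F) (h : 8 * (β : ℤ) - 6 < (F : ℤ)) :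
    Set.BijOn Tset
      {S : Set ℕ | NumericalSemigroup S ∧ AlmostSymmetric S ∧ frob S = F ∧
        (typ S : ℤ) = (F : ℤ) - 2 * (β : ℤ)}
      {T : Set ℕ | NumericalSemigroup T ∧ genus T = β} := by
  refine ⟨?_, ?_, ?_⟩
  · rintro S ⟨hS, ha, hf, ht⟩
    refine ⟨hS.Tset_of_almostSymmetric (hf ▸ hF) ha, ?_⟩
    have hg := genus_add_genus_Tset hS.1
    rw [AlmostSymmetric] at ha
    lia
  · rintro S ⟨hS, -, hf, -⟩ S' ⟨hS', -, hf', -⟩ hT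
    exact eq_of_Tset_eq hS.1 hS'.1 (hf.trans hf'.symm) hT
  · rintro T ⟨hT, hg⟩
    have hgap : ∀ x ∉ T, 2 * x < F := by
      intro x hx
      have := hT.lt_two_mul_genus hx
      lia
    have hTset : Tset (dualSet T F) = T :=
      Tset_dualSet hT.1.1 hF fun x hx => by have := hgap x hx; lia
    have hfrob := frob_dualSet hT.1.1 hF
    have ha := almostSymmetric_dualSet hT hF hgap
    refine ⟨dualSet T F, ⟨numericalSemigroup_dualSet hgap, ha, hfrob, ?_⟩, hTset⟩
    have hsum := genus_add_genus_Tset (numericalSet_dualSet T F)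
    rw [hTset] at hsum
    rw [AlmostSymmetric] at ha
    lia
end

section
/- Let (S_i)_{i ≥ 0} be a sequence of numerical semigroups, each different from ℕ, such that S_i = S_{i+1} ∪ {F(S_{i+1})} for every i, and suppose that for at least one index i one has m(S_i) < F(S_i). Then the sequence of types t(S_i) is eventually constant: there exist N and c such that t(S_i) = c for all i ≥ N. -/
open scoped Classical

open Filter in
/-- Truncating an additively closed set at a large threshold gives a type that does not depend
on the threshold. -/
theorem eventually_typ_union_Ioi {T : Set ℕ} {m : ℕ} (hadd : ∀ a ∈ T, ∀ b ∈ T, a + b ∈ T)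
    (hmT : m ∈ T) (hm0 : 0 < m) (hmin : ∀ x ∈ T, x ≠ 0 → m ≤ x) :
    ∃ c, ∀ᶠ n in atTop, typ (T ∪ Set.Ioi n) = c := by
  have hmul : ∀ x ∈ T, ∀ k, x + k * m ∈ T := by
    intro x hx k
    induction k with
    | zero => simpa using hx
    | succ k ih =>
      have := hadd _ ih _ hmT
      rwa [add_assoc, ← Nat.succ_mul] at this
  set B : Set ℕ := {x | x ∉ T ∧ x + m ∈ T}
  have hlt : ∀ x ∈ B, ∀ y ∈ B, x % m = y % m → ¬ x < y := by
    intro x hx y hy hxy h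
    obtain ⟨k, hk⟩ := (Nat.modEq_iff_dvd' h.le).1 hxy
    obtain _ | k := k
    · simp at hk
      omega
    · refine hy.1 ?_
      have := hmul _ hx.2 k
      have e : x + m + k * m = y := by
        have : m * (k + 1) = k * m + m := by ring
        omega
      rwa [e] at this
  have hBfin : B.Finite := by
    refine Set.Finite.of_finite_image (f := (· % m))
      ((Set.finite_Iio m).subset ?_) ?_
    · rintro _ ⟨x, -, rfl⟩
      exact Nat.mod_lt _ hm0
    · intro x hx y hy hxy
      exact le_antisymm (not_lt.1 (hlt y hy x hx hxy.symm)) (not_lt.1 (hlt x hx y hy hxy))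
  obtain ⟨K, hK⟩ := hBfin.bddAbove
  let p : ℕ → Prop := fun x => ∀ k, x + k * m ∉ T
  have hper : Function.Periodic p m := by
    intro x
    refine propext ⟨fun h k hk => h k ?_, fun h k hk => h (k + 1) ?_⟩
    · have := hadd _ hk _ hmT
      rwa [add_right_comm] at this
    · have e : x + (k + 1) * m = x + m + k * m := by ring
      rwa [e]
  have hpK : ∀ x, K < x → x ∉ T → p x := by
    intro x hx hxT k
    induction k with
    | zero => simpa using hxT
    | succ k ih =>
      intro h
      have : x + k * m ∈ B := ⟨ih, by rwa [add_assoc, ← Nat.succ_mul]⟩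
      have := hK this
      omega
  let L : Set ℕ := {x | x ∈ B ∧ ∀ s ∈ T, s ≠ 0 → x + s ∈ T}
  have hLfin : L.Finite := hBfin.subset fun x hx => hx.1
  have hev : ∀ᶠ n in atTop, ∀ x ∈ B, (∀ s ∈ T, s ≠ 0 → x + s ∈ T ∨ n < x + s) →
      ∀ s ∈ T, s ≠ 0 → x + s ∈ T := by
    refine (eventually_all_finite hBfin).2 fun x _ => ?_
    by_cases hx : ∀ s ∈ T, s ≠ 0 → x + s ∈ T
    · exact Eventually.of_forall fun _ _ => hx
    · push Not at hx
      obtain ⟨s, hs, hs0, hxs⟩ := hx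
      filter_upwards [eventually_ge_atTop (x + s)] with n hn h
      rcases h s hs hs0 with h | h
      · exact absurd h hxs
      · omega
  refine ⟨L.ncard + m.count p, ?_⟩
  filter_upwards [hev, eventually_gt_atTop (K + m)] with n hn hnK
  have hPF : PF (T ∪ Set.Ioi n) =
      L ∪ ↑((Finset.Ico (n + 1 - m) (n + 1 - m + m)).filter p) := by
    ext x
    simp only [PF, Set.mem_union, Set.mem_Ioi, Set.mem_ofPred_eq, Finset.coe_filter,
      Finset.mem_Ico]
    constructor
    · rintro ⟨hx, hxs⟩
      rw [not_or] at hx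
      by_cases hxn : n + 1 - m ≤ x
      · exact Or.inr ⟨⟨hxn, by omega⟩, hpK x (by omega) hx.1⟩
      · have hxB : x ∈ B := by
          refine ⟨hx.1, (hxs m (Or.inl hmT) hm0.ne').resolve_right ?_⟩
          omega
        exact Or.inl ⟨hxB, hn x hxB fun s hs => hxs s (Or.inl hs)⟩
    · rintro (⟨hxB, hx⟩ | ⟨⟨h1, h2⟩, hx⟩)
      · have := hK hxB
        refine ⟨fun h => h.elim hxB.1 fun h => by omega, ?_⟩
        rintro s (hs | hs) hs0
        · exact Or.inl (hx s hs hs0)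
        · exact Or.inr (by omega)
      · have hxT : x ∉ T := by simpa using hx 0
        refine ⟨fun h => h.elim hxT fun h => by omega, ?_⟩
        rintro s (hs | hs) hs0
        · have := hmin s hs hs0
          exact Or.inr (by omega)
        · exact Or.inr (by omega)
  have hdisj : Disjoint L ↑((Finset.Ico (n + 1 - m) (n + 1 - m + m)).filter p) := by
    rw [Set.disjoint_left]
    intro x hx hx'
    have h1 := hK hx.1
    simp only [Finset.coe_filter, Finset.mem_Ico, Set.mem_ofPred_eq] at hx'
    omega
  rw [typ, hPF, Set.ncard_union_eq hdisj hLfin (Finset.finite_toSet _), Set.ncard_coe_finset,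
    Nat.filter_Ico_card_eq_of_periodic _ _ _ hper]

theorem stmt_14 (S : ℕ → Set ℕ)
    (hS : ∀ i, NumericalSemigroup (S i) ∧ S i ≠ Set.univ)
    (hchain : ∀ i, S i = insert (frob (S (i + 1))) (S (i + 1)))
    (hm : ∃ i, mult (S i) < frob (S i)) :
    ∃ N c, ∀ i, N ≤ i → typ (S i) = c := by
  have hfin : ∀ i, (S i)ᶜ.Finite := fun i => (hS i).1.1.2
  have hF : ∀ i, frob (S i) ∉ S i := fun i =>
    Nat.sSup_mem (Set.nonempty_compl.2 (hS i).2) (hfin i).bddAbove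
  have hle : ∀ i x, x ∉ S i → x ≤ frob (S i) := fun i x hx => le_csSup (hfin i).bddAbove hx
  have hanti : Antitone S := antitone_nat_of_succ_le fun i => by
    rw [hchain i]
    exact Set.subset_insert _ _
  have hmono : StrictMono fun i => frob (S i) := strictMono_nat_of_lt_succ fun i => by
    refine lt_of_le_of_ne (hle _ _ fun h => hF i (hanti i.le_succ h)) fun h => hF i ?_
    rw [h, hchain i]
    exact Set.mem_insert _ _
  have hmem : ∀ i x, x ∈ S i → x ≤ frob (S i) → ∀ j, x ∈ S j := by
    intro i x hx hxF j
    rcases le_total j i with hji | hij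
    · exact hanti hji hx
    · induction j, hij using Nat.le_induction with
      | base => exact hx
      | succ j hij ih =>
        rw [hchain j] at ih
        refine ih.resolve_left fun h => ?_
        have : frob (S i) < frob (S (j + 1)) := hmono (Nat.lt_succ_of_le hij)
        omega
  have hST : ∀ i, S i = (⋂ j, S j) ∪ Set.Ioi (frob (S i)) := by
    intro i
    ext x
    constructor
    · intro hx
      rcases le_or_gt x (frob (S i)) with h | h
      · exact Or.inl (Set.mem_iInter.2 (hmem i x hx h))
      · exact Or.inr h
    · rintro (hx | hx)
      · exact Set.mem_iInter.1 hx i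
      · by_contra h
        exact absurd (hle i x h) (not_le.2 hx)
  obtain ⟨i, hi⟩ := hm
  have hne : {x | x ∈ S i ∧ x ≠ 0}.Nonempty :=
    ⟨frob (S i) + 1, by
      by_contra h
      have := hle i (frob (S i) + 1) fun h' => h ⟨h', by omega⟩
      omega⟩
  have hmult : mult (S i) ∈ S i ∧ mult (S i) ≠ 0 := Nat.sInf_mem hne
  obtain ⟨c, hc⟩ := eventually_typ_union_Ioi (T := ⋂ j, S j) (m := mult (S i))
    (fun a ha b hb => Set.mem_iInter.2 fun j =>
      (hS j).1.2 a (Set.mem_iInter.1 ha j) b (Set.mem_iInter.1 hb j))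
    (Set.mem_iInter.2 (hmem i _ hmult.1 hi.le)) (Nat.pos_of_ne_zero hmult.2)
    (fun x hx hx0 => Nat.sInf_le ⟨Set.mem_iInter.1 hx i, hx0⟩)
  obtain ⟨N, hN⟩ := Filter.eventually_atTop.1 (hmono.tendsto_atTop.eventually hc)
  exact ⟨N, c, fun j hj => by rw [hST j]; exact hN j hj⟩
end

section
/- Let H be a numerical set and i a positive integer with 2i ≤ L(H). Then the 2i-fold iterated T-set of H is given by T^{2i}(H) = {x − m_i(H) : x ≥ m_i(H) and x ∈ H ∪ {F_1(H), F_2(H), …, F_i(H)}}. -/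
open scoped Classical

/-- `l(H) = |H ∩ [1, g(H)]|`. -/
noncomputable def lnum (H : Set ℕ) : ℕ := (H ∩ Set.Icc 1 (genus H)).ncard

/-- `L(H)`: `2 l(H)` if `g(H) ∈ H`, and `2 l(H) + 1` otherwise. -/
noncomputable def Lnum (H : Set ℕ) : ℕ :=
  if genus H ∈ H then 2 * lnum H else 2 * lnum H + 1

/-- `m_i(H)`: the `i`-th smallest positive element of `H` (with `m_0(H) = 0`). -/
noncomputable def mElem (H : Set ℕ) (i : ℕ) : ℕ :=
  if i = 0 then 0 else Nat.nth (fun x => x ∈ H ∧ x ≠ 0) (i - 1)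

/-- `F_i(H)`: the `i`-th largest gap of `H` (so `F_1(H) = F(H)`). -/
noncomputable def FGap (H : Set ℕ) (i : ℕ) : ℕ :=
  Nat.nth (fun x => x ∉ H) (genus H - i)

theorem frob_eq_of_isGreatest {K : Set ℕ} {f : ℕ} (hf : f ∉ K) (h : ∀ y, f < y → y ∈ K) :
    frob K = f :=
  IsGreatest.csSup_eq ⟨hf, fun y hy => not_lt.1 fun hlt => hy (h y hlt)⟩

theorem Tset_Tset_eq {K : Set ℕ} {f m : ℕ} (hf : f ∉ K) (hK : ∀ y, f < y → y ∈ K)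
    (hm0 : 0 < m) (hmf : m < f) (hm : m ∈ K) (hmin : ∀ y, 0 < y → y < m → y ∉ K) :
    Tset (Tset K) = {x | x + m ∈ K ∨ x + m = f} := by
  have hF : frob K = f := frob_eq_of_isGreatest hf hK
  have hFT : frob (Tset K) = f - m := by
    apply frob_eq_of_isGreatest
    · simp only [Tset, Set.mem_ofPred_eq, hF, show f - (f - m) = m by omega]
      exact fun h => h.elim (· hm) hm0.ne'
    · intro y hy
      simp only [Tset, Set.mem_ofPred_eq, hF]
      by_cases hyf : f ≤ y
      · right; omega
      · exact .inl (hmin _ (by omega) (by omega))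
  ext x
  simp only [Tset, Set.mem_ofPred_eq, hF] at hFT ⊢
  rw [hFT]
  rcases lt_trichotomy (x + m) f with h | h | h
  · rw [show f - (f - m - x) = x + m by omega]
    have h1 : x + m ≠ 0 := by omega
    have h2 : f - m - x ≠ 0 := by omega
    simp [h1, h2, h.ne, -Nat.add_eq_zero_iff]
  · have h2 : f - m - x = 0 := by omega
    simp [h2, h]
  · have h2 : f - m - x = 0 := by omega
    simp [h2, hK _ h]

theorem count_mem_succ {H : Set ℕ} (h0 : 0 ∈ H) (n : ℕ) :
    Nat.count (· ∈ H) (n + 1) = Nat.count (fun x => x ∈ H ∧ x ≠ 0) (n + 1) + 1 := by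
  induction n with
  | zero => simp [Nat.count_succ, h0]
  | succ n ih =>
    rw [Nat.count_succ, ih, Nat.count_succ _ (n + 1)]
    simp only [ne_eq, Nat.add_eq_zero_iff, one_ne_zero, and_false, not_false_eq_true, and_true]
    omega

theorem NumericalSet.infinite {H : Set ℕ} (hH : NumericalSet H) : H.Infinite := by
  simpa using hH.2.infinite_compl

theorem mElem_eq_nth {H : Set ℕ} (hH : NumericalSet H) (i : ℕ) :
    mElem H i = Nat.nth (· ∈ H) i := by
  rcases i with _ | i
  · simp [mElem, Nat.nth_zero_of_zero (p := (· ∈ H)) hH.1]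
  have hinf : (Set.ofPred fun x => x ∈ H ∧ x ≠ 0).Infinite :=
    hH.infinite.sdiff (Set.finite_singleton 0)
  simp only [mElem, Nat.add_eq_zero_iff, one_ne_zero, and_false, if_false, Nat.add_sub_cancel]
  have hmem := Nat.nth_mem_of_infinite hinf i
  have hcount := Nat.count_nth_of_infinite hinf i
  set m := Nat.nth (fun x => x ∈ H ∧ x ≠ 0) i
  obtain ⟨k, hk⟩ : ∃ k, m = k + 1 := Nat.exists_eq_succ_of_ne_zero hmem.2
  have hc : Nat.count (· ∈ H) m = i + 1 := by
    rw [hk, count_mem_succ hH.1, ← hk, hcount]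
  rw [← hc, Nat.nth_count (p := (· ∈ H)) hmem.1]

theorem lnum_add_one {H : Set ℕ} (h0 : 0 ∈ H) :
    lnum H + 1 = Nat.count (· ∈ H) (genus H + 1) := by
  rw [count_mem_succ h0, lnum, Nat.count_eq_card_filter_range, ← Set.ncard_coe_finset]
  congr 2
  ext x
  simp only [Set.mem_inter_iff, Set.mem_Icc, Finset.coe_filter, Finset.mem_range,
    Set.mem_ofPred_eq, Nat.lt_succ_iff, Nat.one_le_iff_ne_zero]
  tauto

theorem count_add_count_not (p : ℕ → Prop) (n : ℕ) :
    Nat.count p n + Nat.count (fun x => ¬ p x) n = n := by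
  induction n with
  | zero => simp
  | succ n ih =>
    rw [Nat.count_succ, Nat.count_succ]
    split_ifs <;> omega

theorem mElem_le_genus {H : Set ℕ} (hH : NumericalSet H) {i : ℕ} (hi : i ≤ lnum H) :
    mElem H i ≤ genus H := by
  rw [mElem_eq_nth hH, ← Nat.lt_succ_iff]
  apply Nat.nth_lt_of_lt_count
  rw [Nat.succ_eq_add_one, ← lnum_add_one hH.1]
  omega

theorem genus_eq_card {H : Set ℕ} (hf : (Set.ofPred fun x => x ∉ H).Finite) :
    hf.toFinset.card = genus H :=
  (Set.ncard_eq_toFinset_card _ hf).symm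

theorem FGap_notMem {H : Set ℕ} {j : ℕ} (hj : 0 < j) (hjg : j ≤ genus H) : FGap H j ∉ H :=
  Nat.nth_mem (p := fun x => x ∉ H) _ fun hf => by rw [genus_eq_card]; omega

theorem FGap_lt_FGap {H : Set ℕ} {j k : ℕ} (hj : 0 < j) (hjk : j < k)
    (hk : k ≤ genus H) : FGap H k < FGap H j :=
  Nat.nth_lt_nth' (by omega) fun hf => by rw [genus_eq_card]; omega

theorem exists_FGap_eq {H : Set ℕ} (hH : NumericalSet H) {k y : ℕ} (hk : k < genus H)
    (hy : FGap H (k + 1) < y) (hyH : y ∉ H) : ∃ j, 1 ≤ j ∧ j ≤ k ∧ y = FGap H j := by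
  have hf : (Set.ofPred fun x => x ∉ H).Finite := hH.2
  have hlt : Nat.count (fun x => x ∉ H) y < genus H := by
    rw [← genus_eq_card hf]
    exact Nat.count_lt_card hf hyH
  have hgt : genus H - (k + 1) < Nat.count (fun x => x ∉ H) y := by
    by_contra! hle
    have := Nat.nth_le_nth' (p := fun x => x ∉ H) hle fun hf => by rw [genus_eq_card]; omega
    rw [Nat.nth_count (p := fun x => x ∉ H) hyH] at this
    exact absurd hy this.not_gt
  refine ⟨genus H - Nat.count (fun x => x ∉ H) y, by omega, by omega, ?_⟩
  rw [FGap, Nat.sub_sub_self hlt.le, Nat.nth_count (p := fun x => x ∉ H) hyH]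

theorem mElem_mem {H : Set ℕ} (hH : NumericalSet H) (i : ℕ) : mElem H i ∈ H := by
  rw [mElem_eq_nth hH]
  exact Nat.nth_mem_of_infinite (p := (· ∈ H)) hH.infinite i

theorem mElem_lt_FGap {H : Set ℕ} (hH : NumericalSet H) {i : ℕ} (hi : 0 < i)
    (hil : i ≤ lnum H) (hig : i ≤ genus H) : mElem H i < FGap H i := by
  have hc : Nat.count (· ∈ H) (mElem H i) = i := by
    rw [mElem_eq_nth hH]
    exact Nat.count_nth_of_infinite (p := (· ∈ H)) hH.infinite i
  have hsum := count_add_count_not (· ∈ H) (mElem H i)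
  have hle := mElem_le_genus hH hil
  by_contra! h
  have h' : FGap H i < mElem H i :=
    lt_of_le_of_ne h fun he => FGap_notMem hi hig (he ▸ mElem_mem hH i)
  have hlt := Nat.count_strict_mono (p := fun x => x ∉ H) (FGap_notMem hi hig) h'
  rw [FGap, Nat.count_nth fun hf => by rw [genus_eq_card]; omega] at hlt
  omega

theorem lnum_le_genus (H : Set ℕ) : lnum H ≤ genus H := by
  refine (Set.ncard_le_ncard Set.inter_subset_right (Set.finite_Icc _ _)).trans ?_
  simp [← Finset.coe_Icc, Set.ncard_coe_finset]

theorem iterate_Tset_two_mul {H : Set ℕ} (hH : NumericalSet H) {i : ℕ} (hi : i ≤ lnum H) :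
    Tset^[2 * i] H =
      {x | x + mElem H i ∈ H ∨ ∃ j, 1 ≤ j ∧ j ≤ i ∧ x + mElem H i = FGap H j} := by
  induction i with
  | zero =>
    ext x
    simp only [mElem, Function.iterate_zero, mul_zero, id, if_true, add_zero, Set.mem_ofPred_eq]
    exact ⟨.inl, fun h => h.elim id fun ⟨j, h1, h2, _⟩ => by omega⟩
  | succ i ih =>
    have hig : i + 1 ≤ genus H := hi.trans (lnum_le_genus H)
    have hmF : mElem H (i + 1) < FGap H (i + 1) := mElem_lt_FGap hH i.succ_pos hi hig
    have hmm : mElem H i < mElem H (i + 1) := by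
      rw [mElem_eq_nth hH, mElem_eq_nth hH]
      exact Nat.nth_strictMono (p := (· ∈ H)) hH.infinite i.lt_succ_self
    have hFj {j : ℕ} (h1 : 1 ≤ j) (h2 : j ≤ i) : FGap H (i + 1) < FGap H j :=
      FGap_lt_FGap h1 (by omega) hig
    rw [show 2 * (i + 1) = 2 * i + 1 + 1 by ring, Function.iterate_succ_apply',
      Function.iterate_succ_apply', ih (by omega),
      Tset_Tset_eq (f := FGap H (i + 1) - mElem H i) (m := mElem H (i + 1) - mElem H i)]
    · ext x
      simp only [Set.mem_ofPred_eq]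
      rw [show x + (mElem H (i + 1) - mElem H i) + mElem H i = x + mElem H (i + 1) by omega]
      constructor
      · rintro ((h | ⟨j, h1, h2, h⟩) | h)
        · exact .inl h
        · exact .inr ⟨j, h1, by omega, h⟩
        · exact .inr ⟨i + 1, by omega, le_rfl, by omega⟩
      · rintro (h | ⟨j, h1, h2, h⟩)
        · exact .inl (.inl h)
        · rcases h2.lt_or_eq with h2 | rfl
          · exact .inl (.inr ⟨j, h1, by omega, h⟩)
          · right; omega
    · rw [Set.mem_ofPred_eq, show FGap H (i + 1) - mElem H i + mElem H i = FGap H (i + 1) by omega]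
      rintro (h | ⟨j, h1, h2, h⟩)
      · exact FGap_notMem i.succ_pos hig h
      · exact (hFj h1 h2).ne h
    · intro y hy
      by_cases hyH : y + mElem H i ∈ H
      · exact .inl hyH
      · exact .inr (exists_FGap_eq hH hig (by omega) hyH)
    · omega
    · omega
    · left
      rw [show mElem H (i + 1) - mElem H i + mElem H i = mElem H (i + 1) by omega]
      exact mElem_mem hH _
    · rintro y hy0 hy (h | ⟨j, h1, h2, h⟩)
      · have hlo : Nat.nth (· ∈ H) i < y + mElem H i := by rw [← mElem_eq_nth hH]; omega
        have hhi : y + mElem H i < Nat.nth (· ∈ H) (i + 1) := by rw [← mElem_eq_nth hH]; omega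
        exact absurd (Nat.le_nth_of_lt_nth_succ (p := (· ∈ H)) hhi h) hlo.not_ge
      · have := hFj h1 h2
        omega

theorem stmt_16 (H : Set ℕ) (hH : NumericalSet H) (i : ℕ) (hi : 0 < i)
    (h2i : 2 * i ≤ Lnum H) :
    Tset^[2 * i] H =
      (fun x => x - mElem H i) ''
        {x : ℕ | mElem H i ≤ x ∧
          x ∈ H ∪ {y : ℕ | ∃ j, 1 ≤ j ∧ j ≤ i ∧ y = FGap H j}} := by
  have hil : i ≤ lnum H := by
    unfold Lnum at h2i
    split_ifs at h2i <;> omega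
  rw [iterate_Tset_two_mul hH hil]
  ext x
  constructor
  · exact fun hx => ⟨x + mElem H i, ⟨Nat.le_add_left _ _, hx⟩, Nat.add_sub_cancel _ _⟩
  · rintro ⟨y, ⟨hle, hy⟩, rfl⟩
    simpa only [Set.mem_ofPred_eq, Set.mem_union, Nat.sub_add_cancel hle] using hy
end

section
/- Let α be a positive integer and let F be an integer with F > 3α + 3 and F ≡ α (mod 2). Then the number of almost symmetric numerical semigroups with Frobenius number F and type α is at least 2^{F/6 − α/2}. -/
open scoped Classical

/-- The set with Frobenius number `2 * k + α` whose elements up to `k` are `0` and those of `B`,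
which omits the interval `(k, k + α)`, and in which every `x` in `[k + α, 2 * k + α)` lies
exactly when its mirror image `2 * k + α - x` is not in `B`. -/
def mirrorSet (k α : ℕ) (B : Finset ℕ) : Set ℕ :=
  {x | x = 0 ∨ x ∈ B ∨ (k + α ≤ x ∧ x < 2 * k + α ∧ 2 * k + α - x ∉ B) ∨ 2 * k + α < x}

section mirrorSet

variable {k α : ℕ} {B : Finset ℕ}

theorem mem_mirrorSet {x : ℕ} : x ∈ mirrorSet k α B ↔
    x = 0 ∨ x ∈ B ∨ (k + α ≤ x ∧ x < 2 * k + α ∧ 2 * k + α - x ∉ B) ∨ 2 * k + α < x :=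
  Iff.rfl

theorem compl_mirrorSet (hα : 0 < α) (hB : ∀ b ∈ B, 2 * k + α < 3 * b ∧ b ≤ k) :
    (mirrorSet k α B)ᶜ = ↑((Finset.Icc 1 k \ B) ∪ (Finset.Ioo k (k + α) ∪
      (B.image (fun b => 2 * k + α - b) ∪ {2 * k + α}))) := by
  ext x
  simp only [Set.mem_compl_iff, mem_mirrorSet, Finset.coe_union, Set.mem_union, Finset.mem_coe,
    Finset.mem_sdiff, Finset.mem_Icc, Finset.mem_Ioo, Finset.mem_image, Finset.mem_singleton]
  constructor
  · intro h
    push Not at h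
    obtain ⟨h0, hxB, hmid, hle⟩ := h
    by_cases h1 : x ≤ k
    · exact Or.inl ⟨by omega, hxB⟩
    by_cases h2 : x < k + α
    · exact Or.inr (Or.inl (by omega))
    by_cases h3 : x = 2 * k + α
    · exact Or.inr (Or.inr (Or.inr h3))
    exact Or.inr (Or.inr (Or.inl ⟨_, hmid (by omega) (by omega), by omega⟩))
  · rintro (⟨h, hxB⟩ | h | ⟨b, hb, rfl⟩ | rfl)
    · rintro (h' | h' | h' | h') <;> first | exact hxB h' | omega
    · rintro (h' | h' | h' | h') <;> first | omega | (have := hB _ h'; omega)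
    · have := hB b hb
      rintro (h' | h' | h' | h')
      · omega
      · have := hB _ h'; omega
      · exact h'.2.2 (by rwa [Nat.sub_sub_self (by omega)])
      · omega
    · rintro (h' | h' | h' | h') <;> first | omega | (have := hB _ h'; omega)

theorem numericalSemigroup_mirrorSet (hα : 0 < α) (hk : α ≤ k)
    (hB : ∀ b ∈ B, 2 * k + α < 3 * b ∧ b ≤ k) : NumericalSemigroup (mirrorSet k α B) := by
  refine ⟨⟨Or.inl rfl, ?_⟩, ?_⟩
  · rw [compl_mirrorSet hα hB]
    exact Finset.finite_toSet _
  · have large : ∀ x ∈ mirrorSet k α B, x = 0 ∨ 2 * k + α < 3 * x := by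
      rintro x (h | h | h | h)
      · exact Or.inl h
      · exact Or.inr (hB x h).1
      · right; omega
      · right; omega
    intro a ha b hb
    rcases large a ha with rfl | ha'
    · simpa using hb
    rcases large b hb with rfl | hb'
    · simpa using ha
    have hne : a + b ≠ 2 * k + α := by
      intro h
      have hab : 2 * k + α - b = a := by omega
      have hba : 2 * k + α - a = b := by omega
      rcases ha with ha | ha | ha | ha <;> rcases hb with hb | hb | hb | hb
      all_goals first
        | omega
        | exact hb.2.2 (hab ▸ ha)
        | exact ha.2.2 (hba ▸ hb)
        | (have := hB a ha; have := hB b hb; omega)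
    by_cases hlt : 2 * k + α < a + b
    · exact Or.inr (Or.inr (Or.inr hlt))
    · refine Or.inr (Or.inr (Or.inl ⟨by omega, by omega, fun h => ?_⟩))
      have := hB _ h
      omega

theorem frob_mirrorSet (hα : 0 < α) (hB : ∀ b ∈ B, 2 * k + α < 3 * b ∧ b ≤ k) :
    frob (mirrorSet k α B) = 2 * k + α := by
  apply IsGreatest.csSup_eq
  constructor
  · rw [compl_mirrorSet hα hB]
    simp
  · intro x hx
    by_contra h
    exact hx (Or.inr (Or.inr (Or.inr (by omega))))

theorem genus_mirrorSet (hα : 0 < α) (hB : ∀ b ∈ B, 2 * k + α < 3 * b ∧ b ≤ k) :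
    genus (mirrorSet k α B) = k + α := by
  have hsub : B ⊆ Finset.Icc 1 k := fun b hb => by
    have := hB b hb
    simp only [Finset.mem_Icc]
    omega
  have hcard := Finset.card_le_card hsub
  rw [genus, compl_mirrorSet hα hB, Set.ncard_coe_finset, Finset.card_union_of_disjoint,
    Finset.card_union_of_disjoint, Finset.card_union_of_disjoint, Finset.card_sdiff_of_subset hsub,
    Finset.card_image_of_injOn, Nat.card_Icc, Nat.card_Ioo, Finset.card_singleton]
  · rw [Nat.card_Icc] at hcard
    omega
  · intro a ha b hb hab
    have := hB a ha
    have := hB b hb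
    simp only at hab
    omega
  all_goals
    rw [Finset.disjoint_left]
    intro x hx hx'
    simp only [Finset.mem_union, Finset.mem_sdiff, Finset.mem_Icc, Finset.mem_Ioo,
      Finset.mem_image, Finset.mem_singleton] at hx hx'
  · obtain ⟨b, hb, rfl⟩ := hx
    have := hB b hb
    omega
  · rcases hx' with ⟨b, hb, rfl⟩ | rfl
    · have := hB b hb
      omega
    · omega
  · rcases hx' with h | ⟨b, hb, rfl⟩ | rfl
    · omega
    · have := hB b hb
      omega
    · omega

theorem PF_mirrorSet (hα : 0 < α) (hk : α ≤ k) (hB : ∀ b ∈ B, 2 * k + α < 3 * b ∧ b ≤ k) :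
    PF (mirrorSet k α B) = ↑(insert (2 * k + α) (Finset.Ioo k (k + α))) := by
  have hF : 2 * k + α ∉ mirrorSet k α B := by
    rw [← Set.mem_compl_iff, compl_mirrorSet hα hB]
    simp
  ext x
  simp only [Finset.coe_insert, Set.mem_insert_iff, Finset.mem_coe, Finset.mem_Ioo]
  constructor
  · rintro ⟨hx, hPF⟩
    by_contra! hne
    have hxF : x < 2 * k + α := by
      by_contra h
      exact hx (Or.inr (Or.inr (Or.inr (by omega))))
    have hmir : 2 * k + α - x ∈ mirrorSet k α B := by
      by_cases h : x ≤ k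
      · have hx0 : x ≠ 0 := fun h => hx (Or.inl h)
        refine Or.inr (Or.inr (Or.inl ⟨by omega, by omega, ?_⟩))
        rw [Nat.sub_sub_self (by omega)]
        exact fun h => hx (Or.inr (Or.inl h))
      · by_contra h'
        exact hx (Or.inr (Or.inr (Or.inl
          ⟨by omega, hxF, fun hb => h' (Or.inr (Or.inl hb))⟩)))
    have := hPF _ hmir (by omega)
    rw [Nat.add_sub_cancel' (by omega)] at this
    exact hF this
  · rintro (rfl | hx)
    · exact ⟨hF, fun h _ h0 => Or.inr (Or.inr (Or.inr (by omega)))⟩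
    · have gap : ∀ y, k < y ∧ y < k + α → y ∉ mirrorSet k α B := by
        rintro y hy (h | h | h | h) <;> first | omega | (have := hB _ h; omega)
      refine ⟨gap x hx, fun s hs hs0 => ?_⟩
      have hne : x + s ≠ 2 * k + α := fun h => gap s (by omega) hs
      have hs' : 2 * k + α < 3 * s := by
        rcases hs with h | h | h | h <;> first | omega | exact (hB s h).1
      by_cases hlt : 2 * k + α < x + s
      · exact Or.inr (Or.inr (Or.inr hlt))
      · refine Or.inr (Or.inr (Or.inl ⟨by omega, by omega, fun h => ?_⟩))
        have := hB _ h
        omega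

theorem typ_mirrorSet (hα : 0 < α) (hk : α ≤ k) (hB : ∀ b ∈ B, 2 * k + α < 3 * b ∧ b ≤ k) :
    typ (mirrorSet k α B) = α := by
  rw [typ, PF_mirrorSet hα hk hB, Set.ncard_coe_finset, Finset.card_insert_of_notMem,
    Nat.card_Ioo]
  · omega
  · simp only [Finset.mem_Ioo]
    omega

theorem almostSymmetric_mirrorSet (hα : 0 < α) (hk : α ≤ k)
    (hB : ∀ b ∈ B, 2 * k + α < 3 * b ∧ b ≤ k) : AlmostSymmetric (mirrorSet k α B) := by
  rw [AlmostSymmetric, typ_mirrorSet hα hk hB, genus_mirrorSet hα hB, frob_mirrorSet hα hB]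
  push_cast
  ring

theorem subset_of_mirrorSet_subset {C : Finset ℕ} (hα : 0 < α)
    (hB : ∀ b ∈ B, 2 * k + α < 3 * b ∧ b ≤ k) (h : mirrorSet k α B ⊆ mirrorSet k α C) :
    B ⊆ C := by
  intro b hb
  have := hB b hb
  rcases h (show b ∈ mirrorSet k α B from Or.inr (Or.inl hb)) with h | h | h | h
  all_goals first | exact h | omega

end mirrorSet

theorem finite_setOf_numericalSet_frob_eq (F : ℕ) :
    {S : Set ℕ | NumericalSet S ∧ frob S = F}.Finite := by
  refine ((Set.finite_Iic F).finite_subsets.preimage compl_injective.injOn).subset ?_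
  rintro S ⟨hS, rfl⟩ x hx
  exact le_csSup hS.2.bddAbove hx

theorem two_pow_le_ncard_almostSymmetric {k α : ℕ} (hα : 0 < α) (hk : α ≤ k) :
    2 ^ (k - (2 * k + α) / 3) ≤ {S : Set ℕ | NumericalSemigroup S ∧ AlmostSymmetric S ∧
      frob S = 2 * k + α ∧ typ S = α}.ncard := by
  have bounds : ∀ B ∈ (Finset.Ioc ((2 * k + α) / 3) k).powerset,
      ∀ b ∈ B, 2 * k + α < 3 * b ∧ b ≤ k := by
    intro B hB b hb
    have := Finset.mem_Ioc.1 (Finset.mem_powerset.1 hB hb)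
    omega
  have hinj : Set.InjOn (mirrorSet k α) (Finset.Ioc ((2 * k + α) / 3) k).powerset :=
    fun B hB C hC h => (subset_of_mirrorSet_subset hα (bounds B hB) h.subset).antisymm
      (subset_of_mirrorSet_subset hα (bounds C hC) h.superset)
  rw [← Nat.card_Ioc, ← Finset.card_powerset, ← Set.ncard_coe_finset,
    ← hinj.ncard_image]
  refine Set.ncard_le_ncard ?_ ((finite_setOf_numericalSet_frob_eq (2 * k + α)).subset
    fun S hS => ⟨hS.1.1, hS.2.2.1⟩)
  rintro _ ⟨B, hB, rfl⟩
  have hB := bounds B hB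
  exact ⟨numericalSemigroup_mirrorSet hα hk hB, almostSymmetric_mirrorSet hα hk hB,
    frob_mirrorSet hα hB, typ_mirrorSet hα hk hB⟩

theorem stmt_19 (α F : ℕ) (hα : 0 < α) (hF : 3 * α + 3 < F)
    (hpar : F % 2 = α % 2) :
    (2 : ℝ) ^ ((F : ℝ) / 6 - (α : ℝ) / 2) ≤
      (({S : Set ℕ | NumericalSemigroup S ∧ AlmostSymmetric S ∧
          frob S = F ∧ typ S = α}).ncard : ℝ) := by
  obtain ⟨k, rfl⟩ : ∃ k, F = 2 * k + α := by
    refine ⟨(F - α) / 2, ?_⟩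
    omega
  have hexp : ((2 * k + α : ℕ) : ℝ) / 6 - (α : ℝ) / 2 ≤ ((k - (2 * k + α) / 3 : ℕ) : ℝ) := by
    have h : (k : ℝ) ≤ 3 * ((k - (2 * k + α) / 3 : ℕ) : ℝ) + α := by
      exact_mod_cast (by omega : k ≤ 3 * (k - (2 * k + α) / 3) + α)
    push_cast at h ⊢
    linarith
  calc (2 : ℝ) ^ (((2 * k + α : ℕ) : ℝ) / 6 - (α : ℝ) / 2)
      ≤ (2 : ℝ) ^ ((k - (2 * k + α) / 3 : ℕ) : ℝ) :=
        Real.rpow_le_rpow_of_exponent_le one_le_two hexp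
    _ = ((2 ^ (k - (2 * k + α) / 3) : ℕ) : ℝ) := by
        rw [Real.rpow_natCast]
        norm_cast
    _ ≤ _ := by
        exact_mod_cast two_pow_le_ncard_almostSymmetric hα (by omega)
end
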